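/- arXiv:1604.03270 — 2 statements merged into one kernel-verified Lean document; each statement's English description precedes it below -/
import Mathlib

section
/- Let A be a reversible Mealy automaton and let e and f be two edges in the orbit tree o(A). If e is liftable to f, then the label of e is less than or equal to the label of f. -/
open List

variable {Q A : Type*}

/-- Action of a state on words over the alphabet:
`ρ_x(i·s) = ρ_x(i) · ρ_{δ_i(x)}(s)`. -/
def mrho (d : A → Q → Q) (r : Q → A → A) : Q → List A → List A
  | _, [] => []
  | x, i :: s => r x i :: mrho d r (d i x) s

/-- Action of a word of states: `ρ_{x₁⋯x_m} = ρ_{x_m} ∘ ⋯ ∘ ρ_{x₁}`. -/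
def mrhoW (d : A → Q → Q) (r : Q → A → A) : List Q → List A → List A
  | [], s => s
  | x :: u, s => mrhoW d r u (mrho d r x s)

/-- Dual action of a letter on words of states:
`δ_i(x·u) = δ_i(x) · δ_{ρ_x(i)}(u)`. -/
def mdel (d : A → Q → Q) (r : Q → A → A) : A → List Q → List Q
  | _, [] => []
  | i, x :: u => d i x :: mdel d r (r x i) u

/-- Action of a word of letters: `δ_{s₁⋯s_m} = δ_{s_m} ∘ ⋯ ∘ δ_{s₁}`. -/
def mdelW (d : A → Q → Q) (r : Q → A → A) : List A → List Q → List Q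
  | [], u => u
  | i :: s, u => mdelW d r s (mdel d r i u)

/-- Connected component (orbit under the dual action) of a word of states. -/
def mOrbit (d : A → Q → Q) (r : Q → A → A) (u : List Q) : Set (List Q) :=
  { v | ∃ s : List A, mdelW d r s u = v }

/-- The Mealy automaton is invertible. -/
def MInvertible (r : Q → A → A) : Prop := ∀ x : Q, Function.Bijective (r x)

/-- The Mealy automaton is reversible. -/
def MReversible (d : A → Q → Q) : Prop := ∀ i : A, Function.Bijective (d i)

/-- The Mealy automaton is connected. -/
def MConnected (d : A → Q → Q) (r : Q → A → A) : Prop :=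
  ∀ x y : Q, ∃ s : List A, mdelW d r s [x] = [y]

/-- The Mealy automaton is bireversible: invertible, reversible, and for each output
letter `j`, the map sending `x` to `δ_i(x)` (where `i` is the unique letter with
`ρ_x(i) = j`) is a permutation of the (finite) stateset, encoded as injectivity. -/
def MBireversible (d : A → Q → Q) (r : Q → A → A) : Prop :=
  MInvertible r ∧ MReversible d ∧
    ∀ (x y : Q) (i i' : A), r x i = r y i' → d i x = d i' y → x = y

/-- The edge of the orbit tree whose bottom is the component of `e` is liftable
to the edge whose bottom is the component of `f`: every word of `⊥(e)` admits
some word of `⊥(f)` as a suffix. -/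
def EdgeLiftable (d : A → Q → Q) (r : Q → A → A) (e f : List Q) : Prop :=
  ∀ v ∈ mOrbit d r e, ∃ v' ∈ mOrbit d r f, v' <:+ v

lemma aux_mdel_length (d : A → Q → Q) (r : Q → A → A) (u : List Q) :
    ∀ i, (mdel d r i u).length = u.length := by
  induction u with
  | nil => intro i; rfl
  | cons x u ih => intro i; simp [mdel, ih]

lemma aux_length (d : A → Q → Q) (r : Q → A → A) (s : List A) :
    ∀ u, (mdelW d r s u).length = u.length := by
  induction s with
  | nil => intro i; rfl
  | cons x u ih => intro i; simp [mdelW, ih, aux_mdel_length]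

lemma aux_mdel_inj (d : A → Q → Q) (r : Q → A → A) (hrev : MReversible d) (u : List Q) :
    ∀ i v, mdel d r i u = mdel d r i v → u = v := by
  induction u with
  | nil =>
    intro i v h
    cases v with
    | nil => rfl
    | cons y v => simp [mdel] at h
  | cons x u ih =>
    intro i v h
    cases v with
    | nil => simp [mdel] at h
    | cons y v =>
      simp only [mdel, List.cons.injEq] at h
      have hxy := (hrev i).1 h.1
      subst hxy
      rw [ih _ _ h.2]

lemma aux_inj (d : A → Q → Q) (r : Q → A → A) (hrev : MReversible d) (s : List A) :
    ∀ u v, mdelW d r s u = mdelW d r s v → u = v := by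
  induction s with
  | nil => intro u v h; exact h
  | cons i s ih => intro u v h; exact aux_mdel_inj d r hrev u i v (ih _ _ h)

lemma aux_mdel_append (d : A → Q → Q) (r : Q → A → A) (u : List Q) :
    ∀ i, ∃ j, ∀ v, mdel d r i (u ++ v) = mdel d r i u ++ mdel d r j v := by
  induction u with
  | nil => intro i; exact ⟨i, fun v => rfl⟩
  | cons x u ih =>
    intro i
    obtain ⟨j, hj⟩ := ih (r x i)
    exact ⟨j, fun v => by simp [mdel, hj]⟩

lemma aux_append (d : A → Q → Q) (r : Q → A → A) (s : List A) :
    ∀ u, ∃ t, ∀ v, mdelW d r s (u ++ v) = mdelW d r s u ++ mdelW d r t v := by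
  induction s with
  | nil => intro u; exact ⟨[], fun v => rfl⟩
  | cons i s ih =>
    intro u
    obtain ⟨j, hj⟩ := aux_mdel_append d r u i
    obtain ⟨t, ht⟩ := ih (mdel d r i u)
    exact ⟨j :: t, fun v => by simp [mdelW, hj, ht]⟩

lemma aux_comp (d : A → Q → Q) (r : Q → A → A) (s t : List A) :
    ∀ u, mdelW d r t (mdelW d r s u) = mdelW d r (s ++ t) u := by
  induction s with
  | nil => intro u; rfl
  | cons i s ih => intro u; exact ih _

lemma aux_dropLast (d : A → Q → Q) (r : Q → A → A) (s : List A) (u : List Q) :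
    (mdelW d r s u).dropLast = mdelW d r s u.dropLast := by
  rcases List.eq_nil_or_concat u with rfl | ⟨w, x, rfl⟩
  · have := aux_length d r s []
    have h2 : mdelW d r s [] = [] := List.eq_nil_of_length_eq_zero this
    simp [h2]
  · obtain ⟨t, ht⟩ := aux_append d r s w
    have h1 := aux_length d r t [x]
    obtain ⟨y, hy⟩ := List.length_eq_one_iff.1 h1
    simp [ht, hy]

lemma aux_finite [Fintype Q] (d : A → Q → Q) (r : Q → A → A) (u : List Q) :
    (mOrbit d r u).Finite := by
  refine (List.finite_length_eq Q u.length).subset ?_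
  rintro v ⟨s, rfl⟩
  exact aux_length d r s u

lemma aux_orbit_eq [Fintype Q] (d : A → Q → Q) (r : Q → A → A) (hrev : MReversible d)
    (u v : List Q) (hv : v ∈ mOrbit d r u) : mOrbit d r v = mOrbit d r u := by
  obtain ⟨s, rfl⟩ := hv
  apply Set.eq_of_subset_of_ncard_le _ _ (aux_finite d r u)
  · rintro w ⟨t, rfl⟩
    exact ⟨s ++ t, (aux_comp d r s t u).symm⟩
  · -- `mdelW s` maps the orbit of `u` into itself injectively, hence onto
    have hsub : mdelW d r s '' mOrbit d r u ⊆ mOrbit d r u := by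
      rintro _ ⟨_, ⟨t, rfl⟩, rfl⟩
      exact ⟨t ++ s, (aux_comp d r t s u).symm⟩
    have hinj : Function.Injective (mdelW d r s) := fun a b h => aux_inj d r hrev s a b h
    have hmaps : ∀ n, (mdelW d r s)^[n] u ∈ mOrbit d r u := by
      intro n
      induction n with
      | zero => exact ⟨[], rfl⟩
      | succ n ih =>
        rw [Function.iterate_succ_apply']
        exact hsub ⟨_, ih, rfl⟩
    have hper : ∃ n, (mdelW d r s)^[n] (mdelW d r s u) = u := by
      have : ¬ Function.Injective (fun n : ℕ => (⟨_, hmaps n⟩ : mOrbit d r u)) := by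
        haveI := (aux_finite d r u).to_subtype
        exact not_injective_infinite_finite _
      simp only [Function.Injective, not_forall] at this
      obtain ⟨a, b, hab, hne⟩ := this
      have hab' : (mdelW d r s)^[a] u = (mdelW d r s)^[b] u := congrArg Subtype.val hab
      clear hab
      wlog hlt : a < b generalizing a b
      · exact this b a (Ne.symm hne) hab'.symm (by omega)
      obtain ⟨k, rfl⟩ : ∃ k, b = a + (k + 1) := ⟨b - a - 1, by omega⟩
      rw [Function.iterate_add_apply] at hab'
      exact ⟨k, ((hinj.iterate a) hab').symm⟩
    obtain ⟨n, hn⟩ := hper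
    have hit : ∀ n w, ∃ t, (mdelW d r s)^[n] w = mdelW d r t w := by
      intro n
      induction n with
      | zero => intro w; exact ⟨[], rfl⟩
      | succ n ih =>
        intro w
        obtain ⟨t, ht⟩ := ih w
        rw [Function.iterate_succ_apply', ht]
        exact ⟨t ++ s, aux_comp d r t s w⟩
    obtain ⟨t, ht⟩ := hit n (mdelW d r s u)
    refine Set.ncard_le_ncard ?_ (aux_finite d r _)
    rintro _ ⟨t', rfl⟩
    refine ⟨t ++ t', ?_⟩
    rw [← aux_comp, ← ht, hn]

lemma aux_fibre_le [Fintype Q] (d : A → Q → Q) (r : Q → A → A) (hrev : MReversible d)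
    (u v w : List Q) (hv : w ∈ mOrbit d r v) :
    {z ∈ mOrbit d r u | z.dropLast = v}.ncard ≤ {z ∈ mOrbit d r u | z.dropLast = w}.ncard := by
  obtain ⟨s, rfl⟩ := hv
  refine Set.ncard_le_ncard_of_injOn (mdelW d r s) ?_
    (fun a _ b _ h => aux_inj d r hrev s a b h) ((aux_finite d r u).subset (Set.sep_subset _ _))
  rintro _ ⟨⟨t, rfl⟩, rfl⟩
  exact ⟨⟨t ++ s, (aux_comp d r t s u).symm⟩, aux_dropLast d r s _⟩

lemma aux_self (d : A → Q → Q) (r : Q → A → A) (u : List Q) : u ∈ mOrbit d r u := ⟨[], rfl⟩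

lemma aux_label [Fintype Q] (d : A → Q → Q) (r : Q → A → A) (hrev : MReversible d)
    (u : List Q) :
    (mOrbit d r u).ncard / (mOrbit d r u.dropLast).ncard =
      {z ∈ mOrbit d r u | z.dropLast = u.dropLast}.ncard := by
  classical
  have hfin := aux_finite d r u
  have hfin' := aux_finite d r u.dropLast
  have hpos : 0 < (mOrbit d r u.dropLast).ncard :=
    (Set.ncard_pos hfin').2 ⟨_, aux_self d r _⟩
  apply Nat.div_eq_of_eq_mul_right hpos
  rw [Set.ncard_eq_toFinset_card _ hfin, Set.ncard_eq_toFinset_card _ hfin']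
  rw [Finset.card_eq_sum_card_fiberwise (f := List.dropLast) (t := hfin'.toFinset)]
  · rw [Finset.sum_const_nat]
    intro w hw
    rw [Set.Finite.mem_toFinset] at hw
    have h1 := aux_fibre_le d r hrev u _ _ hw
    have h2 := aux_fibre_le d r hrev u w u.dropLast
      (by rw [aux_orbit_eq d r hrev _ _ hw]; exact aux_self d r _)
    rw [le_antisymm h1 h2, ← Set.ncard_coe_finset]
    congr 1
    ext z
    simp
  · intro z hz
    simp only [Set.Finite.coe_toFinset] at hz ⊢
    obtain ⟨s, rfl⟩ := hz
    exact ⟨s, (aux_dropLast d r s u).symm⟩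

/-- If an edge `e` of the orbit tree is liftable to an edge `f`, then the label of `e`
(the ratio of the size of its bottom component by the size of its top component) is at
most the label of `f`. -/
theorem statement5 [Fintype Q] [Fintype A] [Nonempty Q] [Nonempty A]
    (d : A → Q → Q) (r : Q → A → A) (hrev : MReversible d)
    (e f : List Q) (he : e ≠ []) (hf : f ≠ [])
    (h : EdgeLiftable d r e f) :
    (mOrbit d r e).ncard / (mOrbit d r e.dropLast).ncard ≤
      (mOrbit d r f).ncard / (mOrbit d r f.dropLast).ncard := by
  obtain ⟨v, hv, w, rfl⟩ := h e (aux_self d r e)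
  have hvd : v.dropLast ∈ mOrbit d r f.dropLast := by
    obtain ⟨s, rfl⟩ := hv
    exact ⟨s, (aux_dropLast d r s f).symm⟩
  have hvne : v ≠ [] := by
    obtain ⟨s, rfl⟩ := hv
    intro h0
    have := aux_length d r s f
    rw [h0] at this
    exact hf (List.eq_nil_of_length_eq_zero this.symm)
  rw [← aux_orbit_eq d r hrev _ _ hv, ← aux_orbit_eq d r hrev _ _ hvd,
    aux_label d r hrev, aux_label d r hrev]
  have key : ∀ z ∈ {z ∈ mOrbit d r (w ++ v) | z.dropLast = (w ++ v).dropLast},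
      ∃ z' ∈ {z ∈ mOrbit d r v | z.dropLast = v.dropLast}, z = w ++ z' := by
    rintro _ ⟨⟨s, rfl⟩, hz⟩
    obtain ⟨t, ht⟩ := aux_append d r s w
    have hne : mdelW d r t v ≠ [] := by
      intro h0
      have := aux_length d r t v
      rw [h0] at this
      exact hvne (List.eq_nil_of_length_eq_zero this.symm)
    rw [ht, List.dropLast_append_of_ne_nil hne, List.dropLast_append_of_ne_nil hvne] at hz
    obtain ⟨h1, h2⟩ := List.append_inj hz (aux_length d r s w)
    exact ⟨_, ⟨⟨t, rfl⟩, h2⟩, by rw [ht, h1]⟩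
  refine Set.ncard_le_ncard_of_injOn (List.drop w.length) ?_ ?_
    ((aux_finite d r v).subset (Set.sep_subset _ _))
  · intro z hz
    obtain ⟨z', hz', rfl⟩ := key z hz
    simpa using hz'
  · intro a ha b hb hab
    obtain ⟨a', _, rfl⟩ := key a ha
    obtain ⟨b', _, rfl⟩ := key b hb
    simpa using hab
end

section
/- Let A=(Q,Σ,δ,ρ) be a connected bireversible Mealy automaton whose orbit tree o(A) has no active self-liftable branch, and let j be a jungle tree of o(A) with trunk of length n. Then there exists a constant K depending only on j such that for every cyclic j-word u, the map ρ_u : Σ*→Σ* has finite order at most K. -/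
open List

variable {Q A : Type*}

/-- Prefix of length `m` of the infinite word `α : ℕ → Q`. -/
def branchPrefix (α : ℕ → Q) (m : ℕ) : List Q := (List.range m).map α

/-- The orbit tree admits an active self-liftable branch: a branch, represented by
an infinite word `α`, which is `k`-self-liftable for some `k ≥ 1` (every edge at
level `j + k` of the branch is liftable to the edge at level `j`), and active
(its label sequence is not eventually `1`, i.e. the sizes of the components of the
prefixes do not become eventually constant). -/
def HasActiveSelfLiftableBranch (d : A → Q → Q) (r : Q → A → A) : Prop :=
  ∃ (α : ℕ → Q) (k : ℕ), 1 ≤ k ∧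
    (∀ j : ℕ, 1 ≤ j → EdgeLiftable d r (branchPrefix α (j + k)) (branchPrefix α j)) ∧
    ∀ N : ℕ, ∃ m : ℕ, N ≤ m ∧
      (mOrbit d r (branchPrefix α (m + 1))).ncard ≠ (mOrbit d r (branchPrefix α m)).ncard

/-- `t` represents the trunk of a jungle tree: a non-empty finite initial
`1`-self-liftable path (each edge of the trunk is liftable to the preceding one)
such that the bottom of the trunk has at least two legitimate children
(children liftable to the last trunk edge), and every legitimate child has label `1`. -/
def IsJungleTrunk (d : A → Q → Q) (r : Q → A → A) (t : List Q) : Prop :=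
  t ≠ [] ∧
  (∀ j : ℕ, 2 ≤ j → j ≤ t.length → EdgeLiftable d r (t.take j) (t.take (j - 1))) ∧
  (∃ x y : Q, mOrbit d r (t ++ [x]) ≠ mOrbit d r (t ++ [y]) ∧
    EdgeLiftable d r (t ++ [x]) t ∧ EdgeLiftable d r (t ++ [y]) t) ∧
  ∀ x : Q, EdgeLiftable d r (t ++ [x]) t →
    (mOrbit d r (t ++ [x])).ncard = (mOrbit d r t).ncard

/-- `u` is a `j`-word for the jungle tree with trunk `t`: the sequence of connected
components of the prefixes of `u` is an initial path of the jungle tree, i.e. the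
component of each prefix of length `i ≤ |t|` coincides with the component of the
corresponding trunk prefix, and each deeper edge is liftable to the last trunk edge. -/
def IsJWord (d : A → Q → Q) (r : Q → A → A) (t u : List Q) : Prop :=
  (∀ i : ℕ, i ≤ u.length → i ≤ t.length → u.take i ∈ mOrbit d r (t.take i)) ∧
  ∀ l : ℕ, t.length ≤ l → l < u.length → EdgeLiftable d r (u.take (l + 1)) t

/-- A stem is a `j`-word whose length is the length of the trunk. -/
def IsStem (d : A → Q → Q) (r : Q → A → A) (t u : List Q) : Prop :=
  IsJWord d r t u ∧ u.length = t.length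

/-- A cyclic `j`-word is a finite word all of whose powers are `j`-words. -/
def IsCyclicJWord (d : A → Q → Q) (r : Q → A → A) (t u : List Q) : Prop :=
  ∀ k : ℕ, IsJWord d r t (List.flatten (List.replicate k u))

/-- The relation `∼` on stems: `u ∼ v` whenever there is `s` such that `u·s·v` is a
`j`-word and `ρ_{u·s}` acts like the identity on `Σ*`. -/
def StemEquiv (d : A → Q → Q) (r : Q → A → A) (t u v : List Q) : Prop :=
  ∃ s : List Q, IsJWord d r t (u ++ s ++ v) ∧ ∀ w : List A, mrhoW d r (u ++ s) w = w

section helpers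
variable {Q A : Type*} (d : A → Q → Q) (r : Q → A → A)

def mlet (r : Q → A → A) : List Q → A → A
  | [], i => i
  | x :: u, i => mlet r u (r x i)

theorem mdelW_append (s s' : List A) (u : List Q) :
    mdelW d r (s ++ s') u = mdelW d r s' (mdelW d r s u) := by
  induction s generalizing u with
  | nil => rfl
  | cons i s ih => simp [mdelW, ih]

theorem mdel_append (i : A) (a b : List Q) :
    mdel d r i (a ++ b) = mdel d r i a ++ mdel d r (mlet r a i) b := by
  induction a generalizing i with
  | nil => rfl
  | cons x a ih => simp [mdel, mlet, ih]

theorem mrhoW_nil (a : List Q) : mrhoW d r a [] = [] := by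
  induction a with
  | nil => rfl
  | cons x a ih => simp [mrhoW, mrho, ih]

theorem mrhoW_cons (a : List Q) (i : A) (s : List A) :
    mrhoW d r a (i :: s) = mlet r a i :: mrhoW d r (mdel d r i a) s := by
  induction a generalizing i s with
  | nil => rfl
  | cons x a ih => simp [mrhoW, mrho, mdel, mlet, ih]

theorem mdelW_app (s : List A) (a b : List Q) :
    mdelW d r s (a ++ b) = mdelW d r s a ++ mdelW d r (mrhoW d r a s) b := by
  induction s generalizing a b with
  | nil => simp [mdelW, mrhoW_nil]
  | cons i s ih => simp [mdelW, mrhoW_cons, mdel_append, ih]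

theorem mdel_length (i : A) (u : List Q) : (mdel d r i u).length = u.length := by
  induction u generalizing i with
  | nil => rfl
  | cons x u ih => simp [mdel, ih]

theorem mdelW_length (s : List A) (u : List Q) : (mdelW d r s u).length = u.length := by
  induction s generalizing u with
  | nil => rfl
  | cons i s ih => simp [mdelW, ih, mdel_length]

theorem mdel_inj (h : MReversible d) (i : A) : Function.Injective (mdel d r i) := by
  intro u v huv
  induction u generalizing i v with
  | nil =>
    cases v with
    | nil => rfl
    | cons y v => simp [mdel] at huv
  | cons x u ih =>
    cases v with
    | nil => simp [mdel] at huv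
    | cons y v =>
      simp only [mdel, List.cons.injEq] at huv
      obtain ⟨h1, h2⟩ := huv
      have := (h i).1 h1
      subst this
      rw [ih _ h2]

theorem mdelW_inj (h : MReversible d) (s : List A) : Function.Injective (mdelW d r s) := by
  induction s with
  | nil => exact fun _ _ h => h
  | cons i s ih => exact fun u v huv => mdel_inj d r h i (ih huv)

theorem mrho_bij (h : MInvertible r) (x : Q) : Function.Bijective (mrho d r x) := by
  constructor
  · intro s s' hs
    induction s generalizing x s' with
    | nil =>
      cases s' with
      | nil => rfl
      | cons j s' => simp [mrho] at hs
    | cons i s ih =>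
      cases s' with
      | nil => simp [mrho] at hs
      | cons j s' =>
        simp only [mrho, List.cons.injEq] at hs
        obtain ⟨h1, h2⟩ := hs
        have := (h x).1 h1
        subst this
        rw [ih _ h2]
  · intro s
    induction s generalizing x with
    | nil => exact ⟨[], rfl⟩
    | cons j s ih =>
      obtain ⟨i, hi⟩ := (h x).2 j
      obtain ⟨s', hs'⟩ := ih (d i x)
      exact ⟨i :: s', by simp [mrho, hi, hs']⟩

theorem mrhoW_bij (h : MInvertible r) (u : List Q) : Function.Bijective (mrhoW d r u) := by
  induction u with
  | nil => exact Function.bijective_id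
  | cons x u ih => exact ih.comp (mrho_bij d r h x)

theorem mrhoW_append (u v : List Q) (s : List A) :
    mrhoW d r (u ++ v) s = mrhoW d r v (mrhoW d r u s) := by
  induction u generalizing s with
  | nil => rfl
  | cons x u ih => simp [mrhoW, ih]

theorem mrhoW_pow (u : List Q) (k : ℕ) :
    mrhoW d r (List.flatten (List.replicate k u)) = (mrhoW d r u)^[k] := by
  induction k with
  | zero => rfl
  | succ k ih =>
    funext s
    rw [List.replicate_succ, List.flatten_cons, mrhoW_append, ih, Function.iterate_succ_apply]

theorem mdelW_pow (s : List A) (k : ℕ) :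
    mdelW d r (List.flatten (List.replicate k s)) = (mdelW d r s)^[k] := by
  induction k with
  | zero => rfl
  | succ k ih =>
    funext u
    rw [List.replicate_succ, List.flatten_cons, mdelW_append, ih, Function.iterate_succ_apply]

theorem mdelW_back [Finite Q] (h : MReversible d) (s : List A) (v : List Q) :
    ∃ s', mdelW d r s' (mdelW d r s v) = v := by
  have hf : {l : List Q | l.length = v.length}.Finite := List.finite_length_eq Q v.length
  obtain ⟨k, l, hkl, he⟩ := Set.Finite.exists_lt_map_eq_of_forall_mem (α := ℕ)
    (f := fun k => (mdelW d r s)^[k] v)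
    (t := {l : List Q | l.length = v.length}) (by
      intro k
      simp only [Set.mem_setOf_eq]
      rw [← mdelW_pow, mdelW_length]) hf
  refine ⟨List.flatten (List.replicate (l - k - 1) s), ?_⟩
  rw [mdelW_pow]
  apply (mdelW_inj d r h s).iterate k
  rw [← Function.iterate_succ_apply, ← Function.iterate_add_apply]
  have : k + (l - k - 1).succ = l := by omega
  rw [this]
  exact he.symm

theorem orbit_self (u : List Q) : u ∈ mOrbit d r u := ⟨[], rfl⟩

theorem orbit_len {u v : List Q} (h : v ∈ mOrbit d r u) : v.length = u.length := by
  obtain ⟨s, rfl⟩ := h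
  exact mdelW_length d r s u

theorem orbit_trans {u v w : List Q} (h : v ∈ mOrbit d r u) (h' : w ∈ mOrbit d r v) :
    w ∈ mOrbit d r u := by
  obtain ⟨s, rfl⟩ := h
  obtain ⟨s', rfl⟩ := h'
  exact ⟨s ++ s', mdelW_append d r s s' u⟩

theorem orbit_symm [Finite Q] (h : MReversible d) {u v : List Q} (hv : v ∈ mOrbit d r u) :
    u ∈ mOrbit d r v := by
  obtain ⟨s, rfl⟩ := hv
  exact mdelW_back d r h s u

theorem orbit_fin [Finite Q] (u : List Q) : (mOrbit d r u).Finite :=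
  (List.finite_length_eq Q u.length).subset fun _ hv => orbit_len d r hv

theorem mdelW_snoc (s : List A) (v : List Q) (x : Q) :
    ∃ y, mdelW d r s (v ++ [x]) = mdelW d r s v ++ [y] := by
  rw [mdelW_app]
  have := mdelW_length d r (mrhoW d r v s) [x]
  obtain ⟨y, hy⟩ := List.length_eq_one_iff.1 this
  exact ⟨y, by rw [hy]⟩

theorem step [Finite Q] (hi : MInvertible r) (h : MReversible d) (t : List Q)
    (ht : ∀ x : Q, EdgeLiftable d r (t ++ [x]) t →
      (mOrbit d r (t ++ [x])).ncard = (mOrbit d r t).ncard)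
    (v : List Q) (x : Q) (hv : EdgeLiftable d r v t) (hvx : EdgeLiftable d r (v ++ [x]) t) :
    (mOrbit d r (v ++ [x])).ncard ≤ (mOrbit d r v).ncard := by
  apply Set.ncard_le_ncard_of_injOn List.dropLast _ _ (orbit_fin d r v)
  · rintro _ ⟨s, rfl⟩
    obtain ⟨y, hy⟩ := mdelW_snoc d r s v x
    rw [hy, List.dropLast_concat]
    exact ⟨s, rfl⟩
  · intro g1 hg1 g2 hg2 hd
    have h12 : g2 ∈ mOrbit d r g1 := orbit_trans d r (orbit_symm d r h hg1) hg2
    have hg1' := hg1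
    obtain ⟨s1, e1⟩ := hg1
    obtain ⟨s2, e2⟩ := hg2
    obtain ⟨y1, k1⟩ := mdelW_snoc d r s1 v x
    obtain ⟨y2, k2⟩ := mdelW_snoc d r s2 v x
    rw [k1] at e1
    rw [k2] at e2
    have hc : mdelW d r s1 v = mdelW d r s2 v := by
      rw [← e1, ← e2, List.dropLast_concat, List.dropLast_concat] at hd
      exact hd
    rw [← hc] at e2
    obtain ⟨z, hz, a, hac⟩ := hv (mdelW d r s1 v) ⟨s1, rfl⟩
    rw [← hac, List.append_assoc] at e1 e2
    obtain ⟨p, hp⟩ := orbit_symm d r h hz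
    obtain ⟨σ, hσ⟩ := h12
    rw [← e1, ← e2, mdelW_app] at hσ
    have hσ2 := (List.append_inj hσ (mdelW_length d r σ a)).2
    obtain ⟨q1, hq1⟩ := mdelW_snoc d r p z y1
    obtain ⟨q2, hq2⟩ := mdelW_snoc d r p z y2
    rw [hp] at hq1 hq2
    have hl : EdgeLiftable d r (t ++ [q1]) t := by
      rintro _ ⟨τ, rfl⟩
      rw [← hq1, ← mdelW_append]
      obtain ⟨τ', hτ⟩ := (mrhoW_bij d r hi a).2 (p ++ τ)
      have hm : mdelW d r τ' g1 ∈ mOrbit d r (v ++ [x]) := orbit_trans d r hg1' ⟨τ', rfl⟩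
      obtain ⟨v', hv', hs⟩ := hvx _ hm
      refine ⟨v', hv', ?_⟩
      rw [← e1, mdelW_app, hτ] at hs
      refine List.suffix_of_suffix_length_le hs (List.suffix_append _ _) ?_
      rw [mdelW_length, orbit_len d r hv', List.length_append, orbit_len d r hz]
      omega
    have hcard := ht q1 hl
    have himg : List.dropLast '' (mOrbit d r (t ++ [q1])) = mOrbit d r t := by
      ext w
      constructor
      · rintro ⟨_, ⟨s, rfl⟩, rfl⟩
        obtain ⟨y, hy⟩ := mdelW_snoc d r s t q1
        rw [hy, List.dropLast_concat]
        exact ⟨s, rfl⟩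
      · rintro ⟨s, rfl⟩
        obtain ⟨y, hy⟩ := mdelW_snoc d r s t q1
        exact ⟨_, ⟨s, rfl⟩, by rw [hy, List.dropLast_concat]⟩
    have hinj : Set.InjOn List.dropLast (mOrbit d r (t ++ [q1])) :=
      Set.injOn_of_ncard_image_eq (by rw [himg, hcard]) (orbit_fin d r _)
    have hm1 : z ++ [y1] ∈ mOrbit d r (t ++ [q1]) := orbit_symm d r h ⟨p, hq1⟩
    have hm2 : z ++ [y2] ∈ mOrbit d r (t ++ [q1]) := orbit_trans d r hm1 ⟨_, hσ2⟩
    have := hinj hm1 hm2 (by rw [List.dropLast_concat, List.dropLast_concat])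
    rw [← e1, ← e2, this]

theorem jword_card [Finite Q] (hi : MInvertible r) (h : MReversible d) (t : List Q)
    (ht : ∀ x : Q, EdgeLiftable d r (t ++ [x]) t →
      (mOrbit d r (t ++ [x])).ncard = (mOrbit d r t).ncard)
    (w : List Q) (hw : IsJWord d r t w) (m : ℕ) (hm : t.length + m ≤ w.length) :
    (mOrbit d r (w.take (t.length + m))).ncard ≤ (mOrbit d r t).ncard ∧
      EdgeLiftable d r (w.take (t.length + m)) t := by
  induction m with
  | zero =>
    have h0 := hw.1 t.length (by omega) le_rfl
    rw [List.take_length] at h0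
    simp only [Nat.add_zero]
    constructor
    · exact Set.ncard_le_ncard (fun v hv => orbit_trans d r h0 hv) (orbit_fin d r t)
    · exact fun v hv => ⟨v, orbit_trans d r h0 hv, List.suffix_refl v⟩
  | succ m ih =>
    obtain ⟨i1, i2⟩ := ih (by omega)
    have h2 := hw.2 (t.length + m) (by omega) (by omega)
    rw [← Nat.add_assoc]
    refine ⟨?_, h2⟩
    have e : w.take (t.length + m + 1) = w.take (t.length + m) ++ [w[t.length + m]] := by
      rw [List.take_append_getElem]
    rw [e] at h2 ⊢
    exact (step d r hi h t ht _ _ i2 h2).trans i1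

theorem encode [Finite Q] (N : ℕ) (w : List Q) (hN : (mOrbit d r w).ncard ≤ N) :
    ∃ p : (A → Fin N → Fin N) × (Fin N → A → A) × Fin N,
      mrhoW d r w = mrho p.1 p.2.1 p.2.2 := by
  classical
  have hfin := orbit_fin d r w
  have : Finite (mOrbit d r w) := hfin
  have hc : Nat.card (mOrbit d r w) ≤ N := hN
  let f : mOrbit d r w → Fin N := fun x => Fin.castLE hc (Finite.equivFin _ x)
  have hf : Function.Injective f := fun x y hxy =>
    (Finite.equivFin _).injective (Fin.castLE_injective hc hxy)
  let w0 : mOrbit d r w := ⟨w, orbit_self d r w⟩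
  haveI : Nonempty (mOrbit d r w) := ⟨w0⟩
  let g := Function.invFun f
  have hg : ∀ x, g (f x) = x := Function.leftInverse_invFun hf
  let nx : A → mOrbit d r w → mOrbit d r w := fun i o =>
    ⟨mdel d r i o.1, orbit_trans d r o.2 ⟨[i], rfl⟩⟩
  refine ⟨(fun i j => f (nx i (g j)), fun j i => mlet r (g j).1 i, f w0), ?_⟩
  have key : ∀ (s : List A) (o : mOrbit d r w), mrhoW d r o.1 s =
      mrho (fun i j => f (nx i (g j))) (fun j i => mlet r (g j).1 i) (f o) s := by
    intro s
    induction s with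
    | nil => intro o; simp [mrhoW_nil, mrho]
    | cons i s ih =>
      intro o
      rw [mrhoW_cons, mrho, hg]
      congr 1
      exact ih (nx i o)
  funext s
  exact key s w0

end helpers

/-- Every cyclic `j`-word induces an action of finite order, bounded by a uniform
constant depending only on the jungle tree. -/
theorem statement9 [Fintype Q] [Fintype A] [Nonempty Q] [Nonempty A]
    (d : A → Q → Q) (r : Q → A → A)
    (hbi : MBireversible d r) (hconn : MConnected d r)
    (hnab : ¬ HasActiveSelfLiftableBranch d r)
    (t : List Q) (ht : IsJungleTrunk d r t) :
    ∃ K : ℕ, ∀ u : List Q, IsCyclicJWord d r t u →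
      ∃ m : ℕ, 1 ≤ m ∧ m ≤ K ∧ (mrhoW d r u)^[m] = id := by
  obtain ⟨hi, hr, -⟩ := hbi
  obtain ⟨-, -, -, ht⟩ := ht
  set N := (mOrbit d r t).ncard with hN
  let T := (A → Fin N → Fin N) × (Fin N → A → A) × Fin N
  refine ⟨Nat.card T + 1, fun u hu => ?_⟩
  rcases eq_or_ne u [] with rfl | hne
  · exact ⟨1, le_rfl, by omega, rfl⟩
  have hlen : 0 < u.length := List.length_pos_iff.2 hne
  have hb : ∀ k : ℕ, ∃ p : T,
      mrhoW d r (List.flatten (List.replicate (t.length + k) u)) = mrho p.1 p.2.1 p.2.2 := by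
    intro k
    apply encode
    have hL : t.length ≤ (List.flatten (List.replicate (t.length + k) u)).length := by
      simp only [List.length_flatten, List.map_replicate, List.sum_replicate, smul_eq_mul]
      nlinarith
    obtain ⟨m, hm⟩ := Nat.exists_eq_add_of_le hL
    have := (jword_card d r hi hr t ht _ (hu (t.length + k)) m hm.ge).1
    rwa [← hm, List.take_length] at this
  choose p hp using hb
  have : ¬ Function.Injective (fun k : Fin (Nat.card T + 1) => p k) := by
    intro hinj
    have := Nat.card_le_card_of_injective _ hinj
    simp at this
  simp only [Function.Injective, not_forall] at this
  obtain ⟨a, b, hab, hne'⟩ := this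
  have main : ∀ a b : ℕ, a < b → b ≤ Nat.card T → p a = p b →
      ∃ m : ℕ, 1 ≤ m ∧ m ≤ Nat.card T + 1 ∧ (mrhoW d r u)^[m] = id := by
    intro a b hlt hb hab
    refine ⟨b - a, by omega, by omega, ?_⟩
    have e : (mrhoW d r u)^[t.length + a] = (mrhoW d r u)^[t.length + b] := by
      rw [← mrhoW_pow, ← mrhoW_pow, hp, hp, hab]
    funext s
    apply ((mrhoW_bij d r hi u).1.iterate (t.length + a))
    rw [← Function.iterate_add_apply, e]
    have : t.length + a + (b - a) = t.length + b := by omega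
    rw [this]
    rfl
  rcases lt_or_gt_of_ne (fun h : (a : ℕ) = b => hne' (Fin.ext h)) with hlt | hlt
  · exact main a b hlt (by omega) hab
  · exact main b a hlt (by omega) hab.symm
end
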